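/- arXiv:2302.06434 — 2 statements merged into one kernel-verified Lean document; each statement's English description precedes it below -/
import Mathlib

section
/- A matrix L belonging to F lies in the set L of connected-graph Laplacians if and only if L + J is invertible; that is, L = { L ∈ F : det(L + J) ≠ 0 }. -/
open Matrix BigOperators

/-- The `p × p` matrix all of whose entries are `1/p`. -/
noncomputable def matJ (p : ℕ) : Matrix (Fin p) (Fin p) ℝ :=
  Matrix.of fun _ _ => (1 : ℝ) / p

/-- The set `F` of real symmetric `p × p` matrices with nonpositive off-diagonal
entries and zero row sums. -/
def setF (p : ℕ) : Set (Matrix (Fin p) (Fin p) ℝ) :=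
  {L | L.IsSymm ∧ (∀ i j, i ≠ j → L i j ≤ 0) ∧ ∀ i, ∑ j, L i j = 0}

/-- The set `𝓛` of connected-graph Laplacians. -/
def setL (p : ℕ) : Set (Matrix (Fin p) (Fin p) ℝ) :=
  {L | L.PosSemidef ∧ (∀ i j, i ≠ j → L i j ≤ 0) ∧ (∀ i, ∑ j, L i j = 0) ∧
    L.rank = p - 1}

theorem sum_mulVec_eq_zero_of_isSymm {n R : Type*} [Fintype n] [CommRing R] {L : Matrix n n R}
    (hs : L.IsSymm) (hr : ∀ i, ∑ j, L i j = 0) (v : n → R) : ∑ i, (L *ᵥ v) i = 0 := by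
  simp only [mulVec, dotProduct]
  rw [Finset.sum_comm]
  refine Finset.sum_eq_zero fun j _ => ?_
  rw [← Finset.sum_mul, Finset.sum_congr rfl fun i _ => hs.apply j i, hr, zero_mul]

theorem posSemidef_of_mem_setF {p : ℕ} {L : Matrix (Fin p) (Fin p) ℝ} (hL : L ∈ setF p) :
    L.PosSemidef := by
  obtain ⟨hs, ho, hr⟩ := hL
  refine PosSemidef.of_dotProduct_mulVec_nonneg
    (by rwa [IsHermitian, conjTranspose_eq_transpose_of_trivial]) fun x => ?_
  have hsq : ∑ i, ∑ j, L i j * x i ^ 2 = 0 := by simp [← Finset.sum_mul, hr]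
  have hsq' : ∑ i, ∑ j, L i j * x j ^ 2 = 0 := by
    rw [Finset.sum_comm, ← hsq]
    simp only [hs.apply]
  have key : 2 * (star x ⬝ᵥ L *ᵥ x) = ∑ i, ∑ j, -L i j * (x i - x j) ^ 2 := by
    have h : ∑ i, ∑ j, -L i j * (x i - x j) ^ 2 = 2 * (∑ i, ∑ j, x i * (L i j * x j)) -
        ∑ i, ∑ j, L i j * x i ^ 2 - ∑ i, ∑ j, L i j * x j ^ 2 := by
      simp only [Finset.mul_sum, ← Finset.sum_sub_distrib]
      exact Finset.sum_congr rfl fun i _ => Finset.sum_congr rfl fun j _ => by ring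
    rw [h, hsq, hsq']
    simp [dotProduct, mulVec, Finset.mul_sum]
  have : 0 ≤ ∑ i, ∑ j, -L i j * (x i - x j) ^ 2 := by
    refine Finset.sum_nonneg fun i _ => Finset.sum_nonneg fun j _ => ?_
    rcases eq_or_ne i j with rfl | hij
    · simp
    · exact mul_nonneg (neg_nonneg.2 (ho i j hij)) (sq_nonneg _)
  linarith

theorem mulVec_const_eq_zero {n R : Type*} [Fintype n] [CommRing R] {L : Matrix n n R}
    (hr : ∀ i, ∑ j, L i j = 0) (c : R) : L *ᵥ (fun _ => c) = 0 := by
  ext i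
  simp [mulVec, dotProduct, ← Finset.sum_mul, hr]

theorem matJ_mulVec (p : ℕ) (v : Fin p → ℝ) : matJ p *ᵥ v = fun _ => (∑ i, v i) / p := by
  ext i
  simp [matJ, mulVec, dotProduct, ← Finset.mul_sum, div_eq_inv_mul]

theorem rank_eq_pred_iff_ker_const {p : ℕ} (hp : 0 < p) {L : Matrix (Fin p) (Fin p) ℝ}
    (hr : ∀ i, ∑ j, L i j = 0) :
    L.rank = p - 1 ↔ ∀ v, L *ᵥ v = 0 → ∃ c : ℝ, v = fun _ => c := by
  have hrk : L.rank + Module.finrank ℝ (LinearMap.ker L.mulVecLin) = p := by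
    simpa [Matrix.rank] using L.mulVecLin.finrank_range_add_finrank_ker
  let e : LinearMap.ker L.mulVecLin := ⟨fun _ => 1, mulVec_const_eq_zero hr 1⟩
  have he : e ≠ 0 := fun h => one_ne_zero (congrFun (congrArg Subtype.val h) ⟨0, hp⟩)
  have h1 : L.rank = p - 1 ↔ Module.finrank ℝ (LinearMap.ker L.mulVecLin) = 1 := by omega
  rw [h1, finrank_eq_one_iff_of_nonzero' e he]
  constructor
  · intro h v hv
    obtain ⟨c, hc⟩ := h ⟨v, hv⟩
    refine ⟨c, ?_⟩
    ext i
    simpa [e] using (congrFun (congrArg Subtype.val hc) i).symm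
  · rintro h ⟨v, hv⟩
    obtain ⟨c, rfl⟩ := h v hv
    refine ⟨c, Subtype.ext ?_⟩
    ext i
    simp [e]

theorem det_add_matJ_ne_zero_iff_ker_const {p : ℕ} (hp : 0 < p) {L : Matrix (Fin p) (Fin p) ℝ}
    (hs : L.IsSymm) (hr : ∀ i, ∑ j, L i j = 0) :
    (L + matJ p).det ≠ 0 ↔ ∀ v, L *ᵥ v = 0 → ∃ c : ℝ, v = fun _ => c := by
  have hp' : (p : ℝ) ≠ 0 := by positivity
  constructor
  · intro hdet v hv
    refine ⟨(∑ i, v i) / p, sub_eq_zero.1 (eq_zero_of_mulVec_eq_zero hdet ?_)⟩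
    rw [add_mulVec, mulVec_sub, hv, mulVec_const_eq_zero hr, matJ_mulVec]
    ext i
    simp [mul_div_cancel₀ _ hp']
  · intro h hdet
    obtain ⟨v, hv0, hv⟩ := exists_mulVec_eq_zero_iff.2 hdet
    rw [add_mulVec, matJ_mulVec] at hv
    have hsum : ∑ i, v i = 0 := by
      have h2 : ∑ i, ((L *ᵥ v) i + (∑ j, v j) / p) = 0 :=
        Finset.sum_eq_zero fun i _ => congrFun hv i
      rw [Finset.sum_add_distrib, sum_mulVec_eq_zero_of_isSymm hs hr] at h2
      simpa [mul_div_cancel₀ _ hp'] using h2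
    obtain ⟨c, rfl⟩ := h v (by ext i; simpa [hsum] using congrFun hv i)
    have hc : c = 0 := by simpa [hp'] using hsum
    exact hv0 (by ext; simp [hc])

/-- for `L ∈ F`, membership in `𝓛` is equivalent to invertibility of
`L + J`; that is, `𝓛 = { L ∈ F : det (L + J) ≠ 0 }`. -/
theorem mem_setL_iff_det_ne_zero (p : ℕ) (hp : 2 ≤ p) (L : Matrix (Fin p) (Fin p) ℝ)
    (hL : L ∈ setF p) :
    L ∈ setL p ↔ (L + matJ p).det ≠ 0 := by
  obtain ⟨hs, ho, hr⟩ := id hL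
  rw [det_add_matJ_ne_zero_iff_ker_const (by omega) hs hr,
    ← rank_eq_pred_iff_ker_const (by omega) hr]
  exact ⟨fun h => h.2.2.2, fun h => ⟨posSemidef_of_mem_setF hL, ho, hr, h⟩⟩
end

section
/- (Fixed point lemma) Let S be symmetric, L ∈ F with det(L + J) > 0, Q = (L + J)^{-1}, and let M be a p²×p² positive definite matrix. If Δ = 0 is a minimizer of the quadratic model G(Δ) = Tr(Δ(S − Q)) + (1/2) vec(Δ)^T M vec(Δ) + ρ_MCP(L + Δ; λ) over { Δ symmetric : L + Δ ∈ F }, then L is a stationary point of F(·) = Tr(· S) − log det(· + J) + ρ_MCP(·; λ) on F in the following directional sense: for every symmetric matrix D with L + D ∈ F, liminf_{t→0⁺} (F(L + tD) − F(L))/t ≥ 0. -/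
open Matrix BigOperators Topology Filter

/-- The scalar minimax concave penalty `MCP(x; γ, λ)`. -/
noncomputable def MCP (γ lam x : ℝ) : ℝ :=
  if |x| ≤ γ * lam then lam * |x| - x ^ 2 / (2 * γ) else γ * lam ^ 2 / 2

/-- The MCP penalty of a matrix: the sum of `MCP` over all off-diagonal entries. -/
noncomputable def rhoMCP {p : ℕ} (γ lam : ℝ) (L : Matrix (Fin p) (Fin p) ℝ) : ℝ :=
  ∑ i, ∑ j ∈ Finset.univ.filter (fun j => j ≠ i), MCP γ lam (L i j)

/-- Column-stacking of a `p × p` matrix into a vector indexed by `Fin p × Fin p`. -/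
def vecM {p : ℕ} (Δ : Matrix (Fin p) (Fin p) ℝ) : Fin p × Fin p → ℝ :=
  fun q => Δ q.1 q.2

/-- The penalized negative log-likelihood objective
`F(L) = Tr(L S) − log det (L + J) + ρ_MCP(L; λ)`. -/
noncomputable def objF {p : ℕ} (γ lam : ℝ) (S L : Matrix (Fin p) (Fin p) ℝ) : ℝ :=
  (L * S).trace - Real.log (L + matJ p).det + rhoMCP γ lam L

/-- The set `setF p` is convex: it contains `L + t • D` for `t ∈ [0, 1]` as
soon as it contains `L` and `L + D`. -/
lemma add_smul_mem_setF {p : ℕ} {L D : Matrix (Fin p) (Fin p) ℝ} (hL : L ∈ setF p)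
    (hLD : L + D ∈ setF p) {t : ℝ} (ht0 : 0 ≤ t) (ht1 : t ≤ 1) : L + t • D ∈ setF p := by
  obtain ⟨hLs, hLn, hLz⟩ := hL
  obtain ⟨hLDs, hLDn, hLDz⟩ := hLD
  have hcomb : L + t • D = (1 - t) • L + t • (L + D) := by module
  rw [hcomb]
  refine ⟨(hLs.smul _).add (hLDs.smul _), fun i j hij => ?_, fun i => ?_⟩
  · have h1 := mul_nonpos_of_nonneg_of_nonpos (sub_nonneg.2 ht1) (hLn i j hij)
    have h2 := mul_nonpos_of_nonneg_of_nonpos ht0 (hLDn i j hij)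
    simpa only [Matrix.add_apply, Matrix.smul_apply, smul_eq_mul] using add_nonpos h1 h2
  · have h : ∀ j, ((1 - t) • L + t • (L + D)) i j = (1 - t) * L i j + t * (L + D) i j :=
      fun j => rfl
    simp_rw [h, Finset.sum_add_distrib, ← Finset.mul_sum, hLz, hLDz, mul_zero, add_zero]

/-- The directional derivative of `log det` at `A` in direction `D` is `Tr (D A⁻¹)`. -/
lemma hasDerivAt_log_det_add_smul {n : Type*} [Fintype n] [DecidableEq n]
    {A : Matrix n n ℝ} (hA : 0 < A.det) (D : Matrix n n ℝ) :
    HasDerivAt (fun t : ℝ => Real.log (A + t • D).det) (D * A⁻¹).trace 0 := by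
  have hunit : IsUnit A.det := hA.ne'.isUnit
  have hfac : ∀ t : ℝ, (A + t • D).det = A.det * (1 + t • (A⁻¹ * D)).det := fun t => by
    rw [← Matrix.det_mul, mul_add, mul_one, Matrix.mul_smul,
      Matrix.mul_nonsing_inv_cancel_left _ _ hunit]
  have hdet : HasDerivAt (fun t : ℝ => (1 + t • (A⁻¹ * D)).det) (A⁻¹ * D).trace 0 := by
    rw [funext fun t : ℝ => Matrix.det_one_add_smul t (A⁻¹ * D)]
    generalize (Matrix.det (_ : Matrix n n (Polynomial ℝ))).divX.divX = P
    simpa using (((hasDerivAt_id (0 : ℝ)).const_mul (A⁻¹ * D).trace).const_add 1).fun_add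
      ((P.hasDerivAt 0).fun_mul (hasDerivAt_pow 2 (0 : ℝ)))
  have h := (hdet.const_mul A.det).log (by simpa using hA.ne')
  simp_rw [hfac]
  convert h using 1
  rw [Matrix.trace_mul_comm D]
  simp only [zero_smul, add_zero, Matrix.det_one, mul_one]
  field_simp

/-- A real function eventually bounded below by one tending to `0` has nonnegative `liminf`. -/
lemma liminf_nonneg_of_le_of_tendsto_zero {α : Type*} {l : Filter α} {f h : α → ℝ}
    (hh : Tendsto h l (𝓝 0)) (hle : ∀ᶠ x in l, h x ≤ f x) : 0 ≤ liminf f l := by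
  rw [liminf_eq]
  by_cases hb : BddAbove {a | ∀ᶠ x in l, a ≤ f x}
  · refine le_of_forall_lt fun a ha => ?_
    obtain ⟨b, hab, hb0⟩ := exists_between ha
    refine hab.trans_le (le_csSup hb ?_)
    filter_upwards [hh.eventually_const_lt hb0, hle] with x h1 h2 using h1.le.trans h2
  · rw [Real.sSup_of_not_bddAbove hb]

/-- fixed point lemma: if `Δ = 0` minimizes the quadratic model
`G(Δ) = Tr(Δ(S − Q)) + (1/2) vec(Δ)ᵀ M vec(Δ) + ρ_MCP(L + Δ; λ)` over
`{ Δ symmetric : L + Δ ∈ F }` with `M` positive definite, then `L` is a directional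
stationary point of `F` on `F`: for every symmetric `D` with `L + D ∈ F`,
`liminf_{t→0⁺} (F(L + tD) − F(L))/t ≥ 0`. -/
theorem fixed_point_stationary (p : ℕ) (hp : 2 ≤ p) (γ lam : ℝ)
    (hγ : 0 < γ) (hlam : 0 ≤ lam) (S : Matrix (Fin p) (Fin p) ℝ) (hS : S.IsSymm)
    (L : Matrix (Fin p) (Fin p) ℝ) (hLF : L ∈ setF p)
    (hLdet : 0 < (L + matJ p).det)
    (Q : Matrix (Fin p) (Fin p) ℝ) (hQ : Q = (L + matJ p)⁻¹)
    (M : Matrix (Fin p × Fin p) (Fin p × Fin p) ℝ) (hM : M.PosDef)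
    (hmin : ∀ Δ : Matrix (Fin p) (Fin p) ℝ, Δ.IsSymm → L + Δ ∈ setF p →
      rhoMCP γ lam L ≤
        (Δ * (S - Q)).trace + (1 / 2) * (vecM Δ ⬝ᵥ M *ᵥ vecM Δ) +
          rhoMCP γ lam (L + Δ)) :
    ∀ D : Matrix (Fin p) (Fin p) ℝ, D.IsSymm → L + D ∈ setF p →
      0 ≤ Filter.liminf
        (fun t : ℝ => (objF γ lam S (L + t • D) - objF γ lam S L) / t)
        (𝓝[>] (0 : ℝ)) := by
  intro D hD hLD
  set c : ℝ := vecM D ⬝ᵥ M *ᵥ vecM D with hc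
  have hslope := (hasDerivAt_log_det_add_smul hLdet D).tendsto_slope_zero_right
  have ht : Tendsto (fun t : ℝ => t) (𝓝[>] 0) (𝓝 0) := nhdsWithin_le_nhds
  have hlim := (hslope.const_sub (D * Q).trace).sub (ht.mul_const (c / 2))
  rw [← hQ, sub_self, zero_mul, sub_zero] at hlim
  refine liminf_nonneg_of_le_of_tendsto_zero hlim ?_
  filter_upwards [Ioc_mem_nhdsGT (zero_lt_one' ℝ)] with t ⟨ht0, ht1⟩
  have hquad := hmin (t • D) (hD.smul t) (add_smul_mem_setF hLF hLD ht0.le ht1)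
  have hvec : vecM (t • D) = t • vecM D := rfl
  rw [hvec, Matrix.mulVec_smul, smul_dotProduct, dotProduct_smul, ← hc, Matrix.smul_mul,
    Matrix.trace_smul, Matrix.mul_sub, Matrix.trace_sub] at hquad
  simp only [smul_eq_mul] at hquad ⊢
  rw [zero_add, zero_smul, add_zero, le_div_iff₀ ht0]
  unfold objF
  rw [Matrix.add_mul, Matrix.trace_add, Matrix.smul_mul, Matrix.trace_smul, smul_eq_mul,
    add_right_comm L (t • D)]
  field_simp
  linarith
end
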